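/- arXiv:2006.12180 — 6 statements merged into one kernel-verified Lean document; each statement's English description precedes it below -/
import Mathlib

section
/- Let d ≥ 1 be an integer, μ ∈ ℝ^d, Σ a symmetric positive definite real d×d matrix, and for x ≠ μ let f_TIN(x; μ, Σ, θ) denote the MTIN density. Then for every x ∈ ℝ^d with x ≠ μ, the limit as θ → 0⁺ of f_TIN(x; μ, Σ, θ) equals the multivariate normal density f_N(x; μ, Σ) = (2π)^(−d/2) |Σ|^(−1/2) exp(−δ(x)/2). -/
open MeasureTheory Real Filter Set Matrix

/-- Upper incomplete gamma function `Γ(s, x) = ∫ₓ^∞ t^(s-1) e^(-t) dt`. -/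
noncomputable def uGamma (s x : ℝ) : ℝ := ∫ t in Set.Ioi x, t ^ (s - 1) * Real.exp (-t)

/-- Squared Mahalanobis distance `δ(x) = (x-μ)ᵀ Σ⁻¹ (x-μ)`. -/
noncomputable def mahal {d : ℕ} (μ : Fin d → ℝ) (S : Matrix (Fin d) (Fin d) ℝ)
    (x : Fin d → ℝ) : ℝ :=
  (x - μ) ⬝ᵥ (S⁻¹ *ᵥ (x - μ))

/-- The multivariate tail-inflated normal (MTIN) density. -/
noncomputable def mtin (d : ℕ) (μ : Fin d → ℝ) (S : Matrix (Fin d) (Fin d) ℝ) (θ : ℝ)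
    (x : Fin d → ℝ) : ℝ :=
  2 * Real.pi ^ (-(d : ℝ) / 2) * S.det ^ (-(1 : ℝ) / 2) /
      (θ * mahal μ S x ^ ((d : ℝ) / 2 + 1)) *
    (uGamma ((d : ℝ) / 2 + 1) ((1 - θ) * mahal μ S x / 2) -
      uGamma ((d : ℝ) / 2 + 1) (mahal μ S x / 2))

theorem hasDerivAt_uGamma {s x : ℝ} (hs : 0 < s) (hx : 0 < x) :
    HasDerivAt (uGamma s) (-(x ^ (s - 1) * Real.exp (-x))) x := by
  set f : ℝ → ℝ := fun t => t ^ (s - 1) * Real.exp (-t) with hf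
  have hint : IntegrableOn f (Ioi 0) := by
    simpa only [hf, mul_comm] using Real.GammaIntegral_convergent hs
  have hcont : ContinuousOn f (Ioi 0) := fun t ht =>
    ((Real.continuousAt_rpow_const t _ (Or.inl (ne_of_gt ht))).mul
      (by fun_prop)).continuousWithinAt
  have hderiv : HasDerivAt (fun y => ∫ t in (0 : ℝ)..y, f t) (f x) x := by
    refine intervalIntegral.integral_hasDerivAt_right ?_ ?_ (hcont.continuousAt (Ioi_mem_nhds hx))
    · rw [intervalIntegrable_iff_integrableOn_Ioc_of_le hx.le]
      exact hint.mono_set Ioc_subset_Ioi_self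
    · exact hcont.stronglyMeasurableAtFilter isOpen_Ioi x hx
  have hsub := (hasDerivAt_const x (∫ t in Ioi (0 : ℝ), f t)).sub hderiv
  rw [zero_sub] at hsub
  refine hsub.congr_of_eventuallyEq ?_
  filter_upwards [Ioi_mem_nhds hx] with y hy
  have h := intervalIntegral.integral_interval_add_Ioi hint
    (hint.mono_set (Ioi_subset_Ioi (le_of_lt hy)))
  simp only [uGamma, Pi.sub_apply]
  linarith

theorem mahal_pos {d : ℕ} {μ x : Fin d → ℝ} {S : Matrix (Fin d) (Fin d) ℝ} (hS : S.PosDef)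
    (hx : x ≠ μ) : 0 < mahal μ S x := by
  simpa [mahal] using hS.inv.dotProduct_mulVec_pos (sub_ne_zero.mpr hx)

/-- As θ → 0⁺, the MTIN density tends to the multivariate normal density. -/
theorem mtin_tendsto_normal (d : ℕ) (hd : 1 ≤ d) (μ : Fin d → ℝ)
    (S : Matrix (Fin d) (Fin d) ℝ) (hS : S.PosDef) (x : Fin d → ℝ) (hx : x ≠ μ) :
    Tendsto (fun θ : ℝ => mtin d μ S θ x) (nhdsWithin 0 (Set.Ioi 0))
      (nhds ((2 * Real.pi) ^ (-(d : ℝ) / 2) * S.det ^ (-(1 : ℝ) / 2) *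
        Real.exp (-(mahal μ S x) / 2))) := by
  have hδ : 0 < mahal μ S x := mahal_pos hS hx
  unfold mtin
  generalize mahal μ S x = δ at hδ ⊢
  have hline : HasDerivAt (fun θ : ℝ => (1 - θ) * δ / 2) (-(δ / 2)) 0 := by
    convert! (((hasDerivAt_id (0 : ℝ)).const_sub 1).mul_const δ).div_const 2 using 1
    ring
  have hcomp : HasDerivAt (fun θ : ℝ => uGamma ((d : ℝ) / 2 + 1) ((1 - θ) * δ / 2))
      ((δ / 2) ^ ((d : ℝ) / 2 + 1) * Real.exp (-(δ / 2))) 0 := by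
    have hg := hasDerivAt_uGamma (s := (d : ℝ) / 2 + 1) (by positivity) (half_pos hδ)
    convert! HasDerivAt.comp_of_eq (0 : ℝ) hg hline (by ring) using 1
    rw [add_sub_cancel_right, Real.rpow_add_one (half_pos hδ).ne']
    ring
  have hslope := (hcomp.tendsto_slope_zero_right.const_mul
    (2 * Real.pi ^ (-(d : ℝ) / 2) * S.det ^ (-(1 : ℝ) / 2) / δ ^ ((d : ℝ) / 2 + 1)))
  convert! hslope using 1
  · ext θ
    simp only [zero_add, sub_zero, one_mul, smul_eq_mul, div_eq_mul_inv, mul_inv]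
    ring
  · congr 1
    rw [Real.mul_rpow two_pos.le Real.pi_pos.le, Real.div_rpow hδ.le two_pos.le,
      Real.rpow_add_one two_ne_zero, neg_div 2 δ, neg_div 2 (d : ℝ), Real.rpow_neg two_pos.le]
    field_simp
end

section
/- Let d ≥ 1 be an integer, μ ∈ ℝ^d, Σ a symmetric positive definite real d×d matrix, and θ ∈ (0,1). Then the mean vector and covariance matrix of the MTIN distribution are: for every coordinate j, ∫_{ℝ^d} x_j · f_TIN(x; μ, Σ, θ) dx = μ_j, and for every pair of coordinates i, j, ∫_{ℝ^d} (x_i − μ_i)(x_j − μ_j) · f_TIN(x; μ, Σ, θ) dx = v(θ) · Σ_{ij}, where v(θ) = −log(1−θ)/θ. -/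
open MeasureTheory Real Filter Set Matrix

open ProbabilityTheory

/-- The density at `t` of the centred real Gaussian with precision `w`. -/
noncomputable def precisionGaussian (w t : ℝ) : ℝ :=
  √(w / (2 * π)) * exp (-(w / 2) * t ^ 2)

/-- The MTIN density with location `0` and identity scale matrix, as a mixture of Gaussian
densities over their precision. -/
noncomputable def stdMtin {d : ℕ} (θ : ℝ) (y : Fin d → ℝ) : ℝ :=
  θ⁻¹ * ∫ w in (1 - θ)..1, ∏ i, precisionGaussian w (y i)

lemma precisionGaussian_eq_gaussianPDFReal {w : ℝ} (hw : 0 < w) (t : ℝ) :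
    precisionGaussian w t = gaussianPDFReal 0 (w⁻¹).toNNReal t := by
  rw [precisionGaussian, gaussianPDFReal, Real.coe_toNNReal _ (inv_pos.2 hw).le, ← Real.sqrt_inv]
  congr 2
  · field_simp
  · field_simp
    ring

lemma integral_pow_mul_precisionGaussian {w : ℝ} (hw : 0 < w) (n : ℕ) :
    ∫ t, t ^ n * precisionGaussian w t = ∫ t, t ^ n ∂gaussianReal 0 (w⁻¹).toNNReal := by
  rw [integral_gaussianReal_eq_integral_smul (by simpa using hw)]
  simp_rw [precisionGaussian_eq_gaussianPDFReal hw, smul_eq_mul, mul_comm]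

lemma integral_precisionGaussian {w : ℝ} (hw : 0 < w) :
    ∫ t, t ^ 0 * precisionGaussian w t = 1 := by
  rw [integral_pow_mul_precisionGaussian hw]
  simp

lemma integral_id_mul_precisionGaussian {w : ℝ} (hw : 0 < w) :
    ∫ t, t ^ 1 * precisionGaussian w t = 0 := by
  rw [integral_pow_mul_precisionGaussian hw]
  simp

lemma integral_sq_mul_precisionGaussian {w : ℝ} (hw : 0 < w) :
    ∫ t, t ^ 2 * precisionGaussian w t = w⁻¹ := by
  rw [integral_pow_mul_precisionGaussian hw, ← variance_of_integral_eq_zero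
    (X := fun t : ℝ => t) (by fun_prop) (by simp), variance_fun_id_gaussianReal,
    Real.coe_toNNReal _ (inv_pos.2 hw).le]

lemma integrable_pow_mul_exp_neg_mul_sq {b : ℝ} (hb : 0 < b) (n : ℕ) :
    Integrable fun t : ℝ => t ^ n * exp (-b * t ^ 2) := by
  have hn : (-1 : ℝ) < n := by linarith [n.cast_nonneg (α := ℝ)]
  simpa using integrable_rpow_mul_exp_neg_mul_sq hb hn

lemma integrable_monomial_mul_prod_precisionGaussian {d : ℕ} {a : ℝ} (ha : 0 < a)
    (n : Fin d → ℕ) :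
    Integrable (Function.uncurry fun (y : Fin d → ℝ) (w : ℝ) =>
      ∏ i, (y i ^ n i * precisionGaussian w (y i))) (volume.prod (volume.restrict (Ioc a 1))) := by
  have hH : Integrable fun y : Fin d → ℝ =>
      ∏ i, (√(1 / (2 * π)) * (y i ^ n i * exp (-(a / 2) * y i ^ 2))) :=
    Integrable.fintype_prod
      (f := fun i t => √(1 / (2 * π)) * (t ^ n i * exp (-(a / 2) * t ^ 2)))
      fun i => (integrable_pow_mul_exp_neg_mul_sq (half_pos ha) (n i)).const_mul _
  refine (hH.comp_fst (volume.restrict (Ioc a 1))).mono ?_ ?_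
  · refine Continuous.aestronglyMeasurable ?_
    unfold Function.uncurry precisionGaussian
    fun_prop
  · have hmem : ∀ᵐ p : (Fin d → ℝ) × ℝ ∂volume.prod (volume.restrict (Ioc a 1)),
        p.2 ∈ Ioc a 1 :=
      Measure.quasiMeasurePreserving_snd.ae (ae_restrict_mem measurableSet_Ioc)
    filter_upwards [hmem] with p hp
    simp only [Function.uncurry, norm_prod, precisionGaussian]
    refine Finset.prod_le_prod (fun i _ => norm_nonneg _) fun i _ => ?_
    simp only [norm_mul, Real.norm_eq_abs, abs_exp, abs_of_nonneg (Real.sqrt_nonneg _)]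
    rw [mul_left_comm]
    have h1 := hp.1
    have h2 := hp.2
    gcongr

lemma stdMtin_moment {d : ℕ} {θ : ℝ} (hθ : θ ∈ Ioo (0 : ℝ) 1) (n : Fin d → ℕ) :
    Integrable (fun y : Fin d → ℝ => (∏ i, y i ^ n i) * stdMtin θ y) ∧
    ∫ y : Fin d → ℝ, (∏ i, y i ^ n i) * stdMtin θ y =
      θ⁻¹ * ∫ w in (1 - θ)..1, ∏ i, ∫ t, t ^ n i * precisionGaussian w t := by
  have hle : 1 - θ ≤ 1 := by linarith [hθ.1]
  have key := integrable_monomial_mul_prod_precisionGaussian (sub_pos.2 hθ.2) n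
  have hmul (y : Fin d → ℝ) : (∏ i, y i ^ n i) * stdMtin θ y =
      θ⁻¹ * ∫ w in Ioc (1 - θ) 1, ∏ i, (y i ^ n i * precisionGaussian w (y i)) := by
    simp_rw [stdMtin, intervalIntegral.integral_of_le hle, Finset.prod_mul_distrib,
      integral_const_mul]
    ring
  simp_rw [hmul]
  refine ⟨key.integral_prod_left.const_mul _, ?_⟩
  rw [integral_const_mul, integral_integral_swap key, intervalIntegral.integral_of_le hle]
  congr 1
  refine integral_congr_ae (Eventually.of_forall fun w => ?_)
  exact integral_fintype_prod_volume_eq_prod fun i t => t ^ n i * precisionGaussian w t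

lemma integrable_stdMtin {d : ℕ} {θ : ℝ} (hθ : θ ∈ Ioo (0 : ℝ) 1) :
    Integrable (stdMtin θ : (Fin d → ℝ) → ℝ) := by
  simpa using (stdMtin_moment hθ (0 : Fin d → ℕ)).1

lemma integral_stdMtin {d : ℕ} {θ : ℝ} (hθ : θ ∈ Ioo (0 : ℝ) 1) :
    ∫ y : Fin d → ℝ, stdMtin θ y = 1 := by
  have h := (stdMtin_moment hθ (0 : Fin d → ℕ)).2
  have hw : ∫ w in (1 - θ)..1, ∏ _i : Fin d, ∫ t, t ^ 0 * precisionGaussian w t =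
      ∫ _w in (1 - θ)..1, (1 : ℝ) := by
    refine intervalIntegral.integral_congr fun w hw => ?_
    rw [uIcc_of_le (by linarith [hθ.1])] at hw
    simp only [integral_precisionGaussian (w := w) (by linarith [hw.1, hθ.2]), Finset.prod_const_one]
  simp only [Pi.zero_apply] at h
  rw [hw] at h
  simpa [hθ.1.ne'] using h

lemma stdMtin_first_moment {d : ℕ} {θ : ℝ} (hθ : θ ∈ Ioo (0 : ℝ) 1) (i : Fin d) :
    Integrable (fun y : Fin d → ℝ => y i * stdMtin θ y) ∧
    ∫ y : Fin d → ℝ, y i * stdMtin θ y = 0 := by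
  have hmon (y : Fin d → ℝ) : ∏ l, y l ^ (Pi.single i 1 : Fin d → ℕ) l = y i := by
    rw [Finset.prod_eq_single i (fun l _ hl => by simp [hl]) (by simp)]
    simp
  have h := stdMtin_moment hθ (Pi.single i 1)
  simp_rw [hmon] at h
  refine ⟨h.1, h.2.trans ?_⟩
  rw [intervalIntegral.integral_congr (g := fun _ => 0), intervalIntegral.integral_zero, mul_zero]
  intro w hw
  rw [uIcc_of_le (by linarith [hθ.1])] at hw
  refine Finset.prod_eq_zero (Finset.mem_univ i) ?_
  rw [Pi.single_eq_same]
  exact integral_id_mul_precisionGaussian (by linarith [hw.1, hθ.2])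

lemma stdMtin_second_moment {d : ℕ} {θ : ℝ} (hθ : θ ∈ Ioo (0 : ℝ) 1) (i j : Fin d) :
    Integrable (fun y : Fin d → ℝ => y i * y j * stdMtin θ y) ∧
    ∫ y : Fin d → ℝ, y i * y j * stdMtin θ y = if i = j then -log (1 - θ) / θ else 0 := by
  have hpos {w : ℝ} (hw : w ∈ uIcc (1 - θ) 1) : 0 < w := by
    rw [uIcc_of_le (by linarith [hθ.1])] at hw
    linarith [hw.1, hθ.2]
  have hmon (y : Fin d → ℝ) (k : Fin d) : ∏ l, y l ^ (Pi.single k 1 : Fin d → ℕ) l = y k := by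
    rw [Finset.prod_eq_single k (fun l _ hl => by simp [hl]) (by simp)]
    simp
  have h := stdMtin_moment hθ (Pi.single i 1 + Pi.single j 1)
  simp_rw [Pi.add_apply, pow_add, Finset.prod_mul_distrib, hmon, ← pow_add] at h
  refine ⟨h.1, h.2.trans ?_⟩
  split_ifs with hij
  · subst hij
    rw [intervalIntegral.integral_congr (g := fun w => w⁻¹),
      integral_inv_of_pos (sub_pos.2 hθ.2) one_pos, one_div, Real.log_inv]
    · ring
    intro w hw
    dsimp only
    rw [Finset.prod_eq_single i]
    · simpa using integral_sq_mul_precisionGaussian (hpos hw)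
    · intro l _ hl
      simpa [hl] using integral_precisionGaussian (hpos hw)
    · simp
  · rw [intervalIntegral.integral_congr (g := fun _ => 0), intervalIntegral.integral_zero,
      mul_zero]
    intro w hw
    refine Finset.prod_eq_zero (Finset.mem_univ i) ?_
    simpa [hij] using integral_id_mul_precisionGaussian (hpos hw)

lemma uGamma_sub_uGamma {s a b : ℝ} (hs : 0 < s) (ha : 0 ≤ a) (hab : a ≤ b) :
    uGamma s a - uGamma s b = ∫ t in a..b, t ^ (s - 1) * exp (-t) := by
  refine intervalIntegral.integral_Ioi_sub_Ioi ?_ hab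
  refine ((Real.GammaIntegral_convergent hs).mono_set (Ioi_subset_Ioi ha)).congr_fun
    (fun t _ => mul_comm _ _) measurableSet_Ioi

lemma prod_precisionGaussian {d : ℕ} {w : ℝ} (hw : 0 ≤ w) (y : Fin d → ℝ) :
    ∏ i, precisionGaussian w (y i) =
      (w / (2 * π)) ^ ((d : ℝ) / 2) * exp (-(w * (y ⬝ᵥ y / 2))) := by
  simp_rw [precisionGaussian, Finset.prod_mul_distrib, ← Real.exp_sum, ← Finset.mul_sum]
  congr 1
  · rw [Finset.prod_const, Finset.card_univ, Fintype.card_fin, Real.sqrt_eq_rpow,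
      ← Real.rpow_natCast, ← Real.rpow_mul (by positivity)]
    congr 1
    ring
  · simp_rw [dotProduct, ← pow_two]
    congr 1
    ring

lemma uGamma_sub_uGamma_eq_stdMtin {d : ℕ} {θ : ℝ} (hθ : θ ∈ Ioo (0 : ℝ) 1) {y : Fin d → ℝ}
    (hy : 0 < y ⬝ᵥ y) :
    2 * π ^ (-(d : ℝ) / 2) / (θ * (y ⬝ᵥ y) ^ ((d : ℝ) / 2 + 1)) *
      (uGamma ((d : ℝ) / 2 + 1) ((1 - θ) * (y ⬝ᵥ y) / 2) -
        uGamma ((d : ℝ) / 2 + 1) ((y ⬝ᵥ y) / 2)) = stdMtin θ y := by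
  set q := y ⬝ᵥ y with hq
  obtain ⟨h0, h1⟩ := hθ
  have hs : 0 < (d : ℝ) / 2 + 1 := by positivity
  rw [uGamma_sub_uGamma hs (by have := sub_pos.2 h1; positivity) (by nlinarith), stdMtin]
  have hsub := intervalIntegral.integral_comp_mul_right (a := 1 - θ) (b := 1)
    (fun t => t ^ ((d : ℝ) / 2 + 1 - 1) * exp (-t)) (half_pos hy).ne'
  rw [one_mul, smul_eq_mul, ← mul_div_assoc, eq_inv_mul_iff_mul_eq₀ (half_pos hy).ne'] at hsub
  rw [← hsub]
  have hmix : ∫ w in (1 - θ)..1, ∏ i, precisionGaussian w (y i) =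
      (q * π) ^ (-(d : ℝ) / 2) * ∫ w in (1 - θ)..1,
        (w * (q / 2)) ^ ((d : ℝ) / 2 + 1 - 1) * exp (-(w * (q / 2))) := by
    rw [← intervalIntegral.integral_const_mul]
    refine intervalIntegral.integral_congr fun w hw => ?_
    rw [uIcc_of_le (by linarith)] at hw
    have hw0 : 0 < w := by linarith [hw.1]
    rw [prod_precisionGaussian hw0.le, ← hq, ← mul_assoc, add_sub_cancel_right, neg_div,
      Real.rpow_neg (by positivity), ← Real.inv_rpow (by positivity),
      ← Real.mul_rpow (by positivity) (by positivity)]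
    congr 2
    field_simp
  rw [hmix, Real.mul_rpow hy.le pi_pos.le, Real.rpow_add hy, Real.rpow_one, neg_div,
    Real.rpow_neg hy.le]
  have := (Real.rpow_pos_of_pos hy ((d : ℝ) / 2)).ne'
  field_simp

lemma mahal_affine {d : ℕ} (μ y : Fin d → ℝ) {B : Matrix (Fin d) (Fin d) ℝ} (hB : IsUnit B.det) :
    mahal μ (B * Bᵀ) (μ + B *ᵥ y) = y ⬝ᵥ y := by
  have hBt : IsUnit Bᵀ.det := by rwa [det_transpose]
  rw [mahal, add_sub_cancel_left, Matrix.mul_inv_rev, mulVec_mulVec, Matrix.mul_assoc,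
    Matrix.nonsing_inv_mul B hB, Matrix.mul_one, ← vecMul_transpose, ← dotProduct_mulVec,
    mulVec_mulVec, Matrix.mul_nonsing_inv _ hBt, one_mulVec]

lemma mtin_affine {d : ℕ} (μ : Fin d → ℝ) {B : Matrix (Fin d) (Fin d) ℝ} (hB : IsUnit B.det)
    {θ : ℝ} (hθ : θ ∈ Ioo (0 : ℝ) 1) {y : Fin d → ℝ} (hy : y ≠ 0) :
    mtin d μ (B * Bᵀ) θ (μ + B *ᵥ y) = |B.det|⁻¹ * stdMtin θ y := by
  have hq : 0 < y ⬝ᵥ y :=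
    lt_of_le_of_ne (Finset.sum_nonneg fun i _ => mul_self_nonneg _)
      (Ne.symm (mt dotProduct_self_eq_zero.1 hy))
  have hdet : (B * Bᵀ).det ^ (-(1 : ℝ) / 2) = |B.det|⁻¹ := by
    rw [det_mul, det_transpose, neg_div, Real.rpow_neg (mul_self_nonneg _), ← Real.sqrt_eq_rpow,
      Real.sqrt_mul_self_eq_abs]
  rw [mtin, mahal_affine μ y hB, hdet, ← uGamma_sub_uGamma_eq_stdMtin hθ hq]
  ring

lemma integral_mul_mtin {d : ℕ} (hd : 1 ≤ d) (μ : Fin d → ℝ) {B : Matrix (Fin d) (Fin d) ℝ}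
    (hB : IsUnit B.det) {θ : ℝ} (hθ : θ ∈ Ioo (0 : ℝ) 1) (G : (Fin d → ℝ) → ℝ) :
    ∫ x, G x * mtin d μ (B * Bᵀ) θ x = ∫ y, G (μ + B *ᵥ y) * stdMtin θ y := by
  have : Nonempty (Fin d) := ⟨⟨0, hd⟩⟩
  have hdet : 0 < |B.det| := abs_pos.2 hB.ne_zero
  have hemb : MeasurableEmbedding (toLin' B) :=
    (toLin'OfInv (Matrix.nonsing_inv_mul B hB)
      (Matrix.mul_nonsing_inv B hB)).toContinuousLinearEquiv.toHomeomorph.measurableEmbedding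
  have hmap := Real.map_matrix_volume_pi_eq_smul_volume_pi hB.ne_zero
  have hcov (F : (Fin d → ℝ) → ℝ) : ∫ x, F x = |B.det| * ∫ y, F (μ + B *ᵥ y) := by
    have h := hemb.integral_map (μ := volume) fun z => F (μ + z)
    rw [hmap, integral_smul_measure, ENNReal.toReal_ofReal (abs_nonneg _),
      integral_add_left_eq_self, abs_inv, smul_eq_mul, inv_mul_eq_iff_eq_mul₀ hdet.ne'] at h
    simpa only [toLin'_apply] using h
  rw [hcov, ← integral_const_mul]
  refine integral_congr_ae ?_
  filter_upwards [compl_mem_ae_iff.2 (measure_singleton (0 : Fin d → ℝ))] with y hy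
  rw [mtin_affine μ hB hθ hy]
  field_simp

lemma exists_mul_transpose_of_posDef {d : ℕ} {S : Matrix (Fin d) (Fin d) ℝ} (hS : S.PosDef) :
    ∃ B : Matrix (Fin d) (Fin d) ℝ, IsUnit B.det ∧ S = B * Bᵀ := by
  open scoped MatrixOrder in
  obtain ⟨A, hA⟩ := CStarAlgebra.nonneg_iff_eq_mul_star_self.1 hS.posSemidef.nonneg
  rw [star_eq_conjTranspose, conjTranspose_eq_transpose_of_trivial] at hA
  refine ⟨A, isUnit_iff_ne_zero.2 fun h => hS.det_pos.ne' ?_, hA⟩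
  rw [hA, det_mul, h, zero_mul]

/-- Mean vector and covariance matrix of the MTIN distribution:
`E(X) = μ` and `Var(X) = v(θ)·Σ` with `v(θ) = −log(1−θ)/θ`. -/
theorem mtin_mean_and_cov (d : ℕ) (hd : 1 ≤ d) (μ : Fin d → ℝ)
    (S : Matrix (Fin d) (Fin d) ℝ) (hS : S.PosDef) (θ : ℝ) (hθ : θ ∈ Set.Ioo (0 : ℝ) 1) :
    (∀ j, ∫ x : Fin d → ℝ, x j * mtin d μ S θ x = μ j) ∧
    (∀ i j, ∫ x : Fin d → ℝ, (x i - μ i) * (x j - μ j) * mtin d μ S θ x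
        = (-Real.log (1 - θ) / θ) * S i j) := by
  obtain ⟨B, hB, rfl⟩ := exists_mul_transpose_of_posDef hS
  have h1 := stdMtin_first_moment (d := d) hθ
  have h2 := stdMtin_second_moment (d := d) hθ
  refine ⟨fun j => ?_, fun i j => ?_⟩
  · rw [integral_mul_mtin hd μ hB hθ fun x => x j]
    simp_rw [Pi.add_apply, mulVec, dotProduct, add_mul, Finset.sum_mul, mul_assoc]
    rw [integral_add ((integrable_stdMtin hθ).const_mul _)
        (integrable_finsetSum _ fun k _ => (h1 k).1.const_mul _),
      integral_finsetSum _ fun k _ => (h1 k).1.const_mul _]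
    simp_rw [integral_const_mul, (h1 _).2, integral_stdMtin hθ]
    simp
  · rw [integral_mul_mtin hd μ hB hθ fun x => (x i - μ i) * (x j - μ j)]
    have hexp (y : Fin d → ℝ) :
        ((μ + B *ᵥ y) i - μ i) * ((μ + B *ᵥ y) j - μ j) * stdMtin θ y =
          ∑ k, ∑ l, B i k * B j l * (y k * y l * stdMtin θ y) := by
      simp_rw [Pi.add_apply, add_sub_cancel_left, mulVec, dotProduct, Finset.sum_mul_sum,
        Finset.sum_mul]
      refine Finset.sum_congr rfl fun k _ => Finset.sum_congr rfl fun l _ => ?_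
      ring
    simp_rw [hexp]
    rw [integral_finsetSum _ fun k _ =>
      integrable_finsetSum _ fun l _ => (h2 k l).1.const_mul _]
    simp_rw [integral_finsetSum _ fun l _ => (h2 _ l).1.const_mul _, integral_const_mul,
      (h2 _ _).2]
    simp [Matrix.mul_apply, Finset.mul_sum, mul_comm]
end

section
/- The kurtosis-inflation factor k(θ) = θ²/((1−θ)·log²(1−θ)) is strictly increasing on the interval (0,1); moreover k(θ) → 1 as θ → 0⁺ and k(θ) → +∞ as θ → 1⁻. -/
open Real Filter Set

/-- `sinh` is strictly convex on the nonnegative half-line. -/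
theorem strictConvexOn_sinh_Ici : StrictConvexOn ℝ (Ici 0) sinh := by
  apply StrictMonoOn.strictConvexOn_of_deriv (convex_Ici 0) continuous_sinh.continuousOn
  rw [Real.deriv_sinh, interior_Ici]
  exact cosh_strictMonoOn.mono Ioi_subset_Ici_self

theorem strictMonoOn_sinh_div : StrictMonoOn (fun u : ℝ => sinh u / u) (Ioi 0) := by
  intro x hx y hy hxy
  have h := strictConvexOn_sinh_Ici.secant_strict_mono (a := 0) self_mem_Ici
    (Ioi_subset_Ici_self hx) (Ioi_subset_Ici_self hy) (ne_of_gt hx) (ne_of_gt hy) hxy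
  simpa using h

theorem tendsto_sinh_div_nhdsGT_zero :
    Tendsto (fun u : ℝ => sinh u / u) (nhdsWithin 0 (Ioi 0)) (nhds 1) := by
  have h := (hasDerivAt_iff_tendsto_slope.1 (Real.hasDerivAt_sinh 0)).mono_left
    (nhdsWithin_mono 0 fun x (hx : 0 < x) => ne_of_gt hx)
  rw [cosh_zero] at h
  refine h.congr fun u => ?_
  simp [slope_def_field]

theorem tendsto_sinh_div_atTop : Tendsto (fun u : ℝ => sinh u / u) atTop atTop := by
  refine tendsto_atTop_mono' atTop ?_ (tendsto_id.atTop_div_const (by norm_num : (0 : ℝ) < 4))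
  filter_upwards [eventually_gt_atTop 0] with u hu
  have h₁ := quadratic_le_exp_of_nonneg hu.le
  have h₂ : exp (-u) ≤ 1 := exp_le_one_iff.2 (by linarith)
  rw [le_div_iff₀ hu, sinh_eq, id]
  nlinarith

/-- The substitution `u = -log (1 - θ) / 2` turns the factor into `(sinh u / u) ^ 2`. -/
theorem kurtosisFactor_eq_sinh_div_sq {θ : ℝ} (hθ : θ < 1) :
    θ ^ 2 / ((1 - θ) * Real.log (1 - θ) ^ 2) =
      (sinh (-Real.log (1 - θ) / 2) / (-Real.log (1 - θ) / 2)) ^ 2 := by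
  have hpos : 0 < 1 - θ := by linarith
  have h : sinh (-Real.log (1 - θ) / 2) ^ 2 = θ ^ 2 / (4 * (1 - θ)) := by
    have hcosh : cosh (-Real.log (1 - θ)) = 2 * sinh (-Real.log (1 - θ) / 2) ^ 2 + 1 := by
      have h₂ := cosh_two_mul (-Real.log (1 - θ) / 2)
      rw [mul_div_cancel₀ _ (two_ne_zero' ℝ)] at h₂
      linarith [cosh_sq (-Real.log (1 - θ) / 2)]
    rw [cosh_neg, cosh_log hpos] at hcosh
    field_simp at hcosh ⊢
    linarith
  rw [div_pow, h]
  have h4 : (-Real.log (1 - θ) / 2) ^ 2 = Real.log (1 - θ) ^ 2 / 4 := by ring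
  rw [h4, div_div]
  congr 1
  ring

/-- The kurtosis-inflation factor `k(θ) = θ²/((1−θ)·log²(1−θ))` is strictly increasing
on (0,1), tends to 1 as θ → 0⁺, and tends to +∞ as θ → 1⁻. -/
theorem kurtosisFactor_strictMono_and_limits :
    StrictMonoOn (fun θ : ℝ => θ ^ 2 / ((1 - θ) * Real.log (1 - θ) ^ 2)) (Set.Ioo 0 1) ∧
    Tendsto (fun θ : ℝ => θ ^ 2 / ((1 - θ) * Real.log (1 - θ) ^ 2))
      (nhdsWithin 0 (Set.Ioi 0)) (nhds 1) ∧
    Tendsto (fun θ : ℝ => θ ^ 2 / ((1 - θ) * Real.log (1 - θ) ^ 2))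
      (nhdsWithin 1 (Set.Iio 1)) atTop := by
  have hpos : ∀ {θ : ℝ}, 0 < θ → θ < 1 → 0 < -Real.log (1 - θ) / 2 := fun h₀ h₁ => by
    linarith [Real.log_neg (sub_pos.2 h₁) (by linarith)]
  refine ⟨fun x hx y hy hxy => ?_, ?_, ?_⟩
  · simp only [kurtosisFactor_eq_sinh_div_sq hx.2, kurtosisFactor_eq_sinh_div_sq hy.2]
    have hux := hpos hx.1 hx.2
    have hlog := Real.log_lt_log (sub_pos.2 hy.2) (sub_lt_sub_left hxy 1)
    exact pow_lt_pow_left₀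
      (strictMonoOn_sinh_div hux (hpos hy.1 hy.2) (by linarith))
      (div_pos (sinh_pos_iff.2 hux) hux).le two_ne_zero
  · have hu : Tendsto (fun θ : ℝ => -Real.log (1 - θ) / 2)
        (nhdsWithin 0 (Ioi 0)) (nhdsWithin 0 (Ioi 0)) := by
      refine tendsto_nhdsWithin_iff.2 ⟨?_, ?_⟩
      · have hc : ContinuousAt (fun θ : ℝ => -Real.log (1 - θ) / 2) 0 := by
          have : ContinuousAt (fun θ : ℝ => Real.log (1 - θ)) 0 :=
            ContinuousAt.log (by fun_prop) (by norm_num)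
          exact this.neg.div_const 2
        have ht := hc.tendsto
        simp only [sub_zero, Real.log_one, neg_zero, zero_div] at ht
        exact ht.mono_left nhdsWithin_le_nhds
      · filter_upwards [Ioo_mem_nhdsGT (zero_lt_one' ℝ)] with θ hθ using hpos hθ.1 hθ.2
    have ht := (tendsto_sinh_div_nhdsGT_zero.comp hu).pow 2
    rw [one_pow] at ht
    refine ht.congr' ?_
    filter_upwards [Ioo_mem_nhdsGT (zero_lt_one' ℝ)] with θ hθ
    exact (kurtosisFactor_eq_sinh_div_sq hθ.2).symm
  · have hs : Tendsto (fun θ : ℝ => 1 - θ) (nhdsWithin 1 (Iio 1)) (nhdsWithin 0 (Ioi 0)) := by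
      refine tendsto_nhdsWithin_iff.2 ⟨?_, ?_⟩
      · have hc : Continuous fun θ : ℝ => 1 - θ := by fun_prop
        exact (hc.tendsto' 1 0 (sub_self 1)).mono_left nhdsWithin_le_nhds
      · filter_upwards [self_mem_nhdsWithin] with θ hθ using sub_pos.2 (mem_Iio.1 hθ)
    have hu : Tendsto (fun θ : ℝ => -Real.log (1 - θ) / 2) (nhdsWithin 1 (Iio 1)) atTop :=
      (tendsto_neg_atBot_atTop.comp (tendsto_log_nhdsGT_zero.comp hs)).atTop_div_const two_pos
    refine ((tendsto_pow_atTop two_ne_zero).comp (tendsto_sinh_div_atTop.comp hu)).congr' ?_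
    filter_upwards [self_mem_nhdsWithin] with θ hθ
    exact (kurtosisFactor_eq_sinh_div_sq hθ).symm
end

section
/- For every θ ∈ (0,1), both inflation factors strictly exceed one: v(θ) = −log(1−θ)/θ > 1 and k(θ) = θ²/((1−θ)·log²(1−θ)) > 1; hence the MTIN distribution always inflates the variance of the nested normal and is leptokurtic (it cannot be platykurtic). -/
open Real Set

theorem one_add_sq_div_two_lt_cosh {t : ℝ} (ht : 0 < t) : 1 + t ^ 2 / 2 < Real.cosh t := by
  have hs : t / 2 < Real.sinh (t / 2) := Real.self_lt_sinh_iff.2 (half_pos ht)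
  have hc : Real.cosh t = Real.cosh (t / 2) ^ 2 + Real.sinh (t / 2) ^ 2 := by
    rw [← Real.cosh_two_mul, mul_div_cancel₀ t two_ne_zero]
  rw [hc, Real.cosh_sq]
  nlinarith

theorem mul_log_sq_lt_one_sub_sq {x : ℝ} (hx₀ : 0 < x) (hx₁ : x < 1) :
    x * Real.log x ^ 2 < (1 - x) ^ 2 := by
  have h := one_add_sq_div_two_lt_cosh (neg_pos.2 (Real.log_neg hx₀ hx₁))
  rw [Real.cosh_neg, Real.cosh_log hx₀, neg_sq] at h
  have hmul := mul_lt_mul_of_pos_left h hx₀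
  have hinv : x * x⁻¹ = 1 := mul_inv_cancel₀ hx₀.ne'
  linear_combination 2 * hmul + hinv

/-- For every θ ∈ (0,1), both inflation factors strictly exceed one:
`v(θ) = −log(1−θ)/θ > 1` and `k(θ) = θ²/((1−θ)·log²(1−θ)) > 1`. -/
theorem inflation_factors_gt_one :
    ∀ θ ∈ Set.Ioo (0 : ℝ) 1,
      1 < -Real.log (1 - θ) / θ ∧ 1 < θ ^ 2 / ((1 - θ) * Real.log (1 - θ) ^ 2) := by
  rintro θ ⟨h₀, h₁⟩
  have hx₀ : 0 < 1 - θ := sub_pos.2 h₁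
  have hx₁ : 1 - θ < 1 := sub_lt_self 1 h₀
  constructor
  · rw [one_lt_div h₀]
    linarith [Real.log_lt_sub_one_of_pos hx₀ hx₁.ne]
  · have hlog : Real.log (1 - θ) ≠ 0 := (Real.log_neg hx₀ hx₁).ne
    rw [one_lt_div (by positivity)]
    simpa using mul_log_sq_lt_one_sub_sq hx₀ hx₁
end

section
/- Let d ≥ 1 be an integer and θ ∈ (0,1), and define g(t) = (2 π^(−d/2)/θ) · t^(−(d/2+1)) · [Γ(d/2+1, (1−θ)t/2) − Γ(d/2+1, t/2)] for t > 0. Then g is strictly decreasing on (0, ∞). -/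
open MeasureTheory Real Filter Set

lemma uGamma_sub_uGamma_s13 {s x y : ℝ} (hs : 0 < s) (hx : 0 ≤ x) (hxy : x ≤ y) :
    uGamma s x - uGamma s y = ∫ t in x..y, t ^ (s - 1) * Real.exp (-t) := by
  have hint : IntegrableOn (fun t : ℝ => t ^ (s - 1) * Real.exp (-t)) (Ioi 0) :=
    (Real.GammaIntegral_convergent hs).congr_fun (fun t _ => mul_comm _ _) measurableSet_Ioi
  exact intervalIntegral.integral_Ioi_sub_Ioi (hint.mono_set (Ioi_subset_Ioi hx)) hxy

/-- The incomplete gamma increment over `(a t, b t]`, rescaled by `t ^ (-s)`, is a truncated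
Laplace transform. -/
lemma rpow_neg_mul_uGamma_sub_uGamma {s a b t : ℝ} (hs : 0 < s) (ha : 0 ≤ a) (hab : a ≤ b)
    (ht : 0 < t) :
    t ^ (-s) * (uGamma s (t * a) - uGamma s (t * b)) =
      ∫ v in a..b, v ^ (s - 1) * Real.exp (-(t * v)) := by
  rw [uGamma_sub_uGamma_s13 hs (by positivity) (by gcongr),
    ← intervalIntegral.mul_integral_comp_mul_left, ← mul_assoc,
    ← intervalIntegral.integral_const_mul]
  refine intervalIntegral.integral_congr fun v hv => ?_
  have hv0 : 0 ≤ v := ha.trans (by rw [uIcc_of_le hab] at hv; exact hv.1)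
  have hpow : t ^ (-s) * t * t ^ (s - 1) = 1 := by
    rw [← Real.rpow_add_one ht.ne', ← Real.rpow_add ht]
    ring_nf
    exact Real.rpow_zero t
  rw [Real.mul_rpow ht.le hv0]
  linear_combination v ^ (s - 1) * Real.exp (-(t * v)) * hpow

lemma strictAnti_integral_rpow_mul_exp_neg {r a b : ℝ} (ha : 0 < a) (hab : a < b) :
    StrictAnti fun t : ℝ => ∫ v in a..b, v ^ r * Real.exp (-(t * v)) := by
  intro t u htu
  have hcont (t : ℝ) : ContinuousOn (fun v : ℝ => v ^ r * Real.exp (-(t * v))) (Icc a b) :=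
    (continuousOn_id.rpow_const fun v hv => Or.inl (ha.trans_le hv.1).ne').mul (by fun_prop)
  have hlt : ∀ v, a ≤ v → v ^ r * Real.exp (-(u * v)) < v ^ r * Real.exp (-(t * v)) := by
    intro v hv
    have hv0 : 0 < v := ha.trans_le hv
    gcongr
  exact intervalIntegral.integral_lt_integral_of_continuousOn_of_le_of_exists_lt hab
    (hcont u) (hcont t) (fun v hv => (hlt v hv.1.le).le) ⟨a, left_mem_Icc.2 hab.le, hlt a le_rfl⟩

/-- The density generator `g` of the MTIN distribution is strictly decreasing on (0,∞). -/
theorem mtin_generator_strictAntiOn (d : ℕ) (hd : 1 ≤ d) (θ : ℝ)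
    (hθ : θ ∈ Set.Ioo (0 : ℝ) 1) :
    StrictAntiOn
      (fun t : ℝ => (2 * Real.pi ^ (-(d : ℝ) / 2) / θ) * t ^ (-((d : ℝ) / 2 + 1)) *
        (uGamma ((d : ℝ) / 2 + 1) ((1 - θ) * t / 2) - uGamma ((d : ℝ) / 2 + 1) (t / 2)))
      (Set.Ioi 0) := by
  obtain ⟨hθ0, hθ1⟩ := hθ
  have hC : 0 < 2 * Real.pi ^ (-(d : ℝ) / 2) / θ := by positivity
  have key (t : ℝ) (ht : 0 < t) :=
    rpow_neg_mul_uGamma_sub_uGamma (s := (d : ℝ) / 2 + 1) (a := (1 - θ) / 2) (b := 1 / 2)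
      (by positivity) (by linarith) (by linarith) ht
  intro t ht u hu htu
  have hpoint (t : ℝ) : (1 - θ) * t / 2 = t * ((1 - θ) / 2) ∧ t / 2 = t * (1 / 2) := by
    constructor <;> ring
  simp only [(hpoint _).1, (hpoint t).2, (hpoint u).2, mul_assoc _ (_ ^ (-((d : ℝ) / 2 + 1))),
    key t ht, key u hu]
  exact mul_lt_mul_of_pos_left
    (strictAnti_integral_rpow_mul_exp_neg (by linarith) (by linarith) htu) hC
end

section
/- Let d ≥ 1 and n ≥ 1 be integers, let Σ be a symmetric positive definite real d×d matrix, μ ∈ ℝ^d, and let δ_1, …, δ_n ≥ 0 be fixed (the squared Mahalanobis distances δ_i = (x_i−μ)ᵀΣ⁻¹(x_i−μ) of a sample). Define the profile log-likelihood l(θ) = −(n d/2)·log(2π) − (n/2)·log|Σ| + Σ_{i=1}^n log[ (1/θ) ∫_{1−θ}^{1} w^(d/2) exp(−w·δ_i/2) dw ] for θ ∈ (0,1). Then: (i) as θ → 0⁺, l(θ) tends to the finite value −(n d/2)·log(2π) − (n/2)·log|Σ| − (1/2)·Σ_{i=1}^n δ_i (the multivariate normal log-likelihood); and (ii) as θ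 → 1⁻, l(θ) tends to the finite value −(n d/2)·log(2π) − (n/2)·log|Σ| + Σ_{i=1}^n log[ ∫_{0}^{1} w^(d/2) exp(−w·δ_i/2) dw ]. -/
open MeasureTheory Real Filter Set Matrix intervalIntegral

/-- Profile log-likelihood of the inflation parameter θ of the MTIN distribution
(μ and Σ held fixed, δ i the squared Mahalanobis distances of the sample). -/
noncomputable def profileLogLik (d n : ℕ) (S : Matrix (Fin d) (Fin d) ℝ)
    (δ : Fin n → ℝ) (θ : ℝ) : ℝ :=
  -((n : ℝ) * (d : ℝ) / 2) * Real.log (2 * Real.pi) - (n : ℝ) / 2 * Real.log S.det +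
    ∑ i, Real.log ((1 / θ) * ∫ w in (1 - θ)..1, w ^ ((d : ℝ) / 2) * Real.exp (-(w * δ i) / 2))

/-- The averages of a continuous function over `[1 - θ, 1]` tend to its value at `1`. -/
theorem tendsto_inv_mul_integral_one_sub {f : ℝ → ℝ} (hf : Continuous f) :
    Tendsto (fun θ : ℝ => (1 / θ) * ∫ w in (1 - θ)..1, f w) (nhdsWithin 0 (Set.Ioi 0))
      (nhds (f 1)) := by
  have hderiv : HasDerivAt (fun θ : ℝ => ∫ w in (1 - θ)..1, f w) (f 1) 0 := by
    have h := integral_hasDerivAt_left (hf.intervalIntegrable (1 - 0) 1)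
      hf.stronglyMeasurable.stronglyMeasurableAtFilter hf.continuousAt
    have hcomp := h.comp (0 : ℝ) ((hasDerivAt_id (0 : ℝ)).const_sub 1)
    simpa [Function.comp_def] using hcomp
  have hslope := hderiv.tendsto_slope_zero_right
  simpa using hslope

/-- The averages of a continuous function over `[1 - θ, 1]` tend to its integral over `[0, 1]`
as `θ` tends to `1`. -/
theorem tendsto_inv_mul_integral_zero_one {f : ℝ → ℝ} (hf : Continuous f) :
    Tendsto (fun θ : ℝ => (1 / θ) * ∫ w in (1 - θ)..1, f w) (nhdsWithin 1 (Set.Iio 1))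
      (nhds (∫ w in (0 : ℝ)..1, f w)) := by
  have hint : Continuous fun θ : ℝ => ∫ w in (1 - θ)..1, f w := by
    simp_rw [fun θ : ℝ => integral_symm (μ := volume) (f := f) 1 (1 - θ)]
    exact ((continuous_primitive (fun a b => hf.intervalIntegrable a b) 1).comp
      (continuous_const.sub continuous_id)).neg
  have hcont : ContinuousAt (fun θ : ℝ => (1 / θ) * ∫ w in (1 - θ)..1, f w) 1 :=
    (continuousAt_const.div continuousAt_id one_ne_zero).mul hint.continuousAt
  simpa using hcont.tendsto.mono_left nhdsWithin_le_nhds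

theorem continuous_rpow_mul_exp_neg {p : ℝ} (hp : 0 ≤ p) (a : ℝ) :
    Continuous fun w : ℝ => w ^ p * Real.exp (-(w * a) / 2) :=
  (Real.continuous_rpow_const hp).mul (by fun_prop)

theorem integral_rpow_mul_exp_neg_pos {p : ℝ} (hp : 0 ≤ p) (a : ℝ) :
    0 < ∫ w in (0 : ℝ)..1, w ^ p * Real.exp (-(w * a) / 2) :=
  intervalIntegral_pos_of_pos_on ((continuous_rpow_mul_exp_neg hp a).intervalIntegrable 0 1)
    (fun _ hw => mul_pos (Real.rpow_pos_of_pos hw.1 p) (Real.exp_pos _)) one_pos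

/-- The profile log-likelihood `l(θ)` of the MTIN inflation parameter has finite limits
at both endpoints of (0,1): as θ → 0⁺ it tends to the multivariate normal log-likelihood
`−(nd/2)log(2π) − (n/2)log|Σ| − (1/2)Σᵢ δᵢ`, and as θ → 1⁻ it tends to
`−(nd/2)log(2π) − (n/2)log|Σ| + Σᵢ log ∫₀¹ w^(d/2) e^(−wδᵢ/2) dw`. -/
theorem profileLogLik_limits (d n : ℕ) (hd : 1 ≤ d) (hn : 1 ≤ n)
    (μ : Fin d → ℝ) (S : Matrix (Fin d) (Fin d) ℝ) (hS : S.PosDef)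
    (δ : Fin n → ℝ) (hδ : ∀ i, 0 ≤ δ i) :
    Tendsto (profileLogLik d n S δ) (nhdsWithin 0 (Set.Ioi 0))
      (nhds (-((n : ℝ) * (d : ℝ) / 2) * Real.log (2 * Real.pi)
        - (n : ℝ) / 2 * Real.log S.det - (1 / 2) * ∑ i, δ i)) ∧
    Tendsto (profileLogLik d n S δ) (nhdsWithin 1 (Set.Iio 1))
      (nhds (-((n : ℝ) * (d : ℝ) / 2) * Real.log (2 * Real.pi)
        - (n : ℝ) / 2 * Real.log S.det
        + ∑ i, Real.log (∫ w in (0 : ℝ)..1, w ^ ((d : ℝ) / 2) * Real.exp (-(w * δ i) / 2)))) := by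
  have hp : (0 : ℝ) ≤ (d : ℝ) / 2 := by positivity
  unfold profileLogLik
  constructor
  · have hsum : -(1 / 2) * ∑ i, δ i =
        ∑ i, Real.log ((1 : ℝ) ^ ((d : ℝ) / 2) * Real.exp (-(1 * δ i) / 2)) := by
      rw [Finset.mul_sum]
      refine Finset.sum_congr rfl fun i _ => ?_
      rw [Real.one_rpow, one_mul, Real.log_exp]
      ring
    rw [sub_eq_add_neg _ ((1 / 2) * ∑ i, δ i), ← neg_mul, hsum]
    refine tendsto_const_nhds.add (tendsto_finsetSum _ fun i _ => ?_)
    exact (tendsto_inv_mul_integral_one_sub (continuous_rpow_mul_exp_neg hp (δ i))).log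
      (by positivity)
  · refine tendsto_const_nhds.add (tendsto_finsetSum _ fun i _ => ?_)
    exact (tendsto_inv_mul_integral_zero_one (continuous_rpow_mul_exp_neg hp (δ i))).log
      (integral_rpow_mul_exp_neg_pos hp (δ i)).ne'
end
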